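/- arXiv:1707.09713 — 3 statements merged into one kernel-verified Lean document; each statement's English description precedes it below -/
import Mathlib

section
/- Angular spectrum and singleton minimizers (Proposition 4): Let A ⊆ ℤ² be finite with z·e₂ ≤ −1 for every z ∈ A, and suppose A contains two linearly independent points. Then: (1) for every z ∈ A there exists a singleton minimizer y ∈ A with θ(y) = θ(z); consequently the set of angles of singleton minimizers equals the angular spectrum Θ(A) = {θ(z) : z ∈ A}; (2) every singleton minimizer y satisfies ‖y‖ ≤ ‖z‖ for every z ∈ A with θ(z) = θ(y), i.e. y is the unique shortest element of A in its direction; in particular, for each angle in Θ(A) there is exactly one singleton minimizer with that angle. -/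
noncomputable section

/-- The Euclidean norm on `ℝ × ℝ`. -/
def enorm2 (v : ℝ × ℝ) : ℝ := Real.sqrt (v.1 ^ 2 + v.2 ^ 2)

/-- The standard inner product on `ℝ × ℝ`. -/
def dot2 (v w : ℝ × ℝ) : ℝ := v.1 * w.1 + v.2 * w.2

/-- Rotation by +90°. -/
def gperp (g : ℝ × ℝ) : ℝ × ℝ := (-g.2, g.1)

/-- The angle in `[0, π)` that the line `ℝ·z` makes with the positive x-axis. -/
def lineAngle (z : ℝ × ℝ) : ℝ :=
  if Complex.arg ⟨z.1, z.2⟩ < 0 then Complex.arg ⟨z.1, z.2⟩ + Real.pi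
  else if Complex.arg ⟨z.1, z.2⟩ = Real.pi then 0
  else Complex.arg ⟨z.1, z.2⟩

/-- `Ψ_g(A)`: the set of points of `A` closest to the line `ℝ·g`. -/
def Psi (g : ℝ × ℝ) (A : Set (ℝ × ℝ)) : Set (ℝ × ℝ) :=
  {y ∈ A | ∀ y' ∈ A, |dot2 (gperp g) y| ≤ |dot2 (gperp g) y'|}

/-- `y` is a singleton minimizer of `A` if `Ψ_g(A) = {y}` for some unit vector `g`. -/
def SingletonMinimizer (A : Set (ℝ × ℝ)) (y : ℝ × ℝ) : Prop :=
  ∃ g : ℝ × ℝ, enorm2 g = 1 ∧ Psi g A = {y}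

/-- Cast a lattice point to `ℝ × ℝ`. -/
def intCast2 (z : ℤ × ℤ) : ℝ × ℝ := ((z.1 : ℝ), (z.2 : ℝ))

/-- In the open lower half plane, two vectors span the same line iff they are linearly dependent. -/
theorem lineAngle_eq_iff {v w : ℝ × ℝ} (hv : v.2 < 0) (hw : w.2 < 0) :
    lineAngle v = lineAngle w ↔ v.1 * w.2 = v.2 * w.1 := by
  have hv_arg : Complex.arg ⟨v.1, v.2⟩ < 0 := Complex.arg_neg_iff.2 hv
  have hw_arg : Complex.arg ⟨w.1, w.2⟩ < 0 := Complex.arg_neg_iff.2 hw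
  have hv_ne : (⟨v.1, v.2⟩ : ℂ) ≠ 0 := fun h => hv.ne (congrArg Complex.im h)
  have hw_ne : (⟨w.1, w.2⟩ : ℂ) ≠ 0 := fun h => hw.ne (congrArg Complex.im h)
  have hray := Complex.sameRay_iff (x := ⟨v.1, v.2⟩) (y := ⟨w.1, w.2⟩)
  simp only [hv_ne, hw_ne, false_or] at hray
  rw [lineAngle, lineAngle, if_pos hv_arg, if_pos hw_arg, add_left_inj, ← hray]
  constructor
  · intro h
    obtain ⟨r, s, hr, hs, hrs⟩ := h.exists_pos hv_ne hw_ne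
    have hre : r * v.1 = s * w.1 := by simpa using congrArg Complex.re hrs
    have him : r * v.2 = s * w.2 := by simpa using congrArg Complex.im hrs
    refine mul_left_cancel₀ hr.ne' ?_
    linear_combination w.2 * hre - w.1 * him
  · intro h
    refine Or.inr (Or.inr ⟨-w.2, -v.2, neg_pos.2 hw, neg_pos.2 hv, ?_⟩)
    apply Complex.ext
    · simp only [Complex.real_smul, Complex.mul_re, Complex.ofReal_re, Complex.ofReal_im]
      linear_combination -h
    · simp only [Complex.real_smul, Complex.mul_im, Complex.ofReal_re, Complex.ofReal_im]
      ring

/-- Any nonzero vector may serve as the normal of the line defining a singleton minimizer. -/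
theorem SingletonMinimizer.of_normal {A : Set (ℝ × ℝ)} {y n : ℝ × ℝ} (hn : n ≠ 0) (hy : y ∈ A)
    (hlt : ∀ w ∈ A, w ≠ y → |dot2 n y| < |dot2 n w|) : SingletonMinimizer A y := by
  have hsq : 0 < n.1 ^ 2 + n.2 ^ 2 := by
    by_contra! h
    exact hn (Prod.ext (by simp only [Prod.fst_zero]; nlinarith [sq_nonneg n.1, sq_nonneg n.2])
      (by simp only [Prod.snd_zero]; nlinarith [sq_nonneg n.1, sq_nonneg n.2]))
  have hpos : 0 < enorm2 n := Real.sqrt_pos.2 hsq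
  have hnorm : enorm2 n ^ 2 = n.1 ^ 2 + n.2 ^ 2 := Real.sq_sqrt hsq.le
  have hdot (w : ℝ × ℝ) :
      |dot2 (gperp (n.2 / enorm2 n, -n.1 / enorm2 n)) w| = |dot2 n w| / enorm2 n := by
    rw [← abs_of_pos hpos, ← abs_div, abs_of_pos hpos]
    congr 1
    simp only [dot2, gperp]
    ring
  refine ⟨(n.2 / enorm2 n, -n.1 / enorm2 n), ?_, ?_⟩
  · rw [enorm2, Real.sqrt_eq_one]
    field_simp
    linarith
  · ext w
    simp only [Psi, hdot, Set.mem_ofPred_eq, Set.mem_singleton_iff, div_le_div_iff_of_pos_right hpos]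
    constructor
    · rintro ⟨hw, hmin⟩
      by_contra hne
      exact (hlt w hw hne).not_ge (hmin y hy)
    · rintro rfl
      refine ⟨hy, fun w' hw' => ?_⟩
      rcases eq_or_ne w' w with rfl | hne
      · exact le_rfl
      · exact (hlt w' hw' hne).le

theorem SingletonMinimizer.mem {A : Set (ℝ × ℝ)} {y : ℝ × ℝ} (h : SingletonMinimizer A y) :
    y ∈ A := by
  obtain ⟨g, -, hg⟩ := h
  have hy : y ∈ Psi g A := hg ▸ Set.mem_singleton y
  exact hy.1

/-- A singleton minimizer in the lower half plane lies strictly above every other point of its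
direction. -/
theorem SingletonMinimizer.snd_lt {A : Set (ℝ × ℝ)} (hA : ∀ z ∈ A, z.2 < 0) {y z : ℝ × ℝ}
    (h : SingletonMinimizer A y) (hz : z ∈ A) (hangle : lineAngle z = lineAngle y)
    (hne : z ≠ y) : z.2 < y.2 := by
  have hy := h.mem
  have hcross := (lineAngle_eq_iff (hA z hz) (hA y hy)).1 hangle
  obtain ⟨g, -, hg⟩ := h
  have hmem : y ∈ Psi g A := hg ▸ Set.mem_singleton y
  have hlt : |dot2 (gperp g) y| < |dot2 (gperp g) z| := by
    by_contra! hle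
    have hz' : z ∈ Psi g A := ⟨hz, fun w hw => hle.trans (hmem.2 w hw)⟩
    rw [hg] at hz'
    exact hne hz'
  have hscale : -y.2 * |dot2 (gperp g) z| = -z.2 * |dot2 (gperp g) y| := by
    rw [← abs_of_pos (neg_pos.2 (hA y hy)), ← abs_of_pos (neg_pos.2 (hA z hz)), ← abs_mul,
      ← abs_mul]
    congr 1
    simp only [dot2]
    linear_combination -(gperp g).1 * hcross
  by_contra! hle
  nlinarith [hA y hy, abs_nonneg (dot2 (gperp g) y)]

theorem enorm2_le_of_lineAngle_eq {y z : ℝ × ℝ} (hy : y.2 < 0) (hz : z.2 < 0)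
    (hangle : lineAngle z = lineAngle y) (hle : z.2 ≤ y.2) : enorm2 y ≤ enorm2 z := by
  have hcross := (lineAngle_eq_iff hz hy).1 hangle
  have hsq : y.2 ^ 2 ≤ z.2 ^ 2 := by nlinarith
  have hscale : y.2 ^ 2 * (z.1 ^ 2 + z.2 ^ 2) = z.2 ^ 2 * (y.1 ^ 2 + y.2 ^ 2) := by
    linear_combination (z.1 * y.2 + z.2 * y.1) * hcross
  refine Real.sqrt_le_sqrt (le_of_mul_le_mul_left ?_ (pow_pos (neg_pos.2 hy) 2))
  rw [neg_sq, hscale]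
  exact mul_le_mul_of_nonneg_right hsq (by positivity)

/-- The topmost lattice point of `A` in a given direction is a singleton minimizer. -/
theorem singletonMinimizer_of_snd_le {A : Finset (ℤ × ℤ)} (hA : ∀ z ∈ A, z.2 ≤ -1) {y : ℤ × ℤ}
    (hy : y ∈ A) (hmax : ∀ w ∈ A, w.1 * y.2 = w.2 * y.1 → w.2 ≤ y.2) :
    SingletonMinimizer (intCast2 '' ↑A) (intCast2 y) := by
  obtain ⟨M, hM⟩ : ∃ M : ℤ, ∀ w ∈ A, -w.2 ≤ M := by
    obtain ⟨M, hM⟩ := (A.image fun w => -w.2).bddAbove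
    exact ⟨M, fun w hw => hM (Finset.mem_coe.2 (Finset.mem_image_of_mem _ hw))⟩
  have hypos : 0 < -y.2 := by linarith [hA y hy]
  have hMpos : 0 < M := hypos.trans_le (hM y hy)
  -- The normal is `(2M+1) y^⊥ + e₂`, an integral vector almost perpendicular to `y`.
  have hdot (w : ℤ × ℤ) :
      dot2 (-((2 * M + 1) * y.2 : ℝ), (2 * M + 1) * y.1 + 1) (intCast2 w) =
        (((2 * M + 1) * (w.2 * y.1 - w.1 * y.2) + w.2 : ℤ) : ℝ) := by
    simp only [dot2, intCast2]
    push_cast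
    ring
  refine SingletonMinimizer.of_normal
    (n := (-((2 * M + 1) * y.2 : ℝ), (2 * M + 1) * y.1 + 1)) ?_ ⟨y, hy, rfl⟩ ?_
  · intro h
    have hzero := hdot y
    rw [h] at hzero
    simp only [dot2, Prod.fst_zero, Prod.snd_zero, zero_mul, add_zero] at hzero
    have : (2 * M + 1) * (y.2 * y.1 - y.1 * y.2) + y.2 = 0 := by exact_mod_cast hzero.symm
    nlinarith
  · rintro _ ⟨w, hw, rfl⟩ hne
    rw [hdot, hdot]
    norm_cast
    have hywy : (2 * M + 1) * (y.2 * y.1 - y.1 * y.2) + y.2 = y.2 := by ring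
    rw [hywy, abs_of_neg (neg_pos.1 hypos), lt_abs]
    have hyM := hM y hy
    have hwM := hM w hw
    have hwneg := hA w hw
    rcases lt_trichotomy (w.2 * y.1 - w.1 * y.2) 0 with hc | hc | hc
    · right
      nlinarith
    · right
      rw [hc, mul_zero, zero_add]
      have hcross : w.1 * y.2 = w.2 * y.1 := by linarith
      have hsnd : w.2 ≠ y.2 := by
        intro heq
        refine hne (congrArg intCast2 (Prod.ext ?_ heq))
        rw [heq, mul_comm] at hcross
        exact mul_left_cancel₀ (neg_pos.1 hypos).ne hcross
      have hlt := lt_of_le_of_ne (hmax w hw hcross) hsnd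
      linarith
    · left
      nlinarith

/-- **Angular spectrum and singleton minimizers (Proposition 4).**
Let `A ⊆ ℤ²` be finite with `z·e₂ ≤ −1` for every `z ∈ A`, containing two linearly
independent points.  Then: (1) for every `z ∈ A` there is a singleton minimizer `y ∈ A`
with `θ(y) = θ(z)`; consequently the set of angles of singleton minimizers equals the
angular spectrum `Θ(A) = {θ(z) : z ∈ A}`; (2) every singleton minimizer `y` satisfies
`‖y‖ ≤ ‖z‖` for every `z ∈ A` with `θ(z) = θ(y)`, and for each angle of `Θ(A)` there is
exactly one singleton minimizer with that angle. -/
theorem angular_spectrum_singleton_minimizers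
    (A : Finset (ℤ × ℤ)) (hA1 : ∀ z ∈ A, z.2 ≤ -1)
    (hA2 : ∃ z ∈ A, ∃ z' ∈ A, z.1 * z'.2 - z.2 * z'.1 ≠ 0) :
    (∀ z ∈ A, ∃ y ∈ A, SingletonMinimizer (intCast2 '' ↑A) (intCast2 y) ∧
        lineAngle (intCast2 y) = lineAngle (intCast2 z)) ∧
    (lineAngle '' {y ∈ intCast2 '' ↑A | SingletonMinimizer (intCast2 '' ↑A) y}
        = lineAngle '' (intCast2 '' ↑A)) ∧
    (∀ y, SingletonMinimizer (intCast2 '' ↑A) y →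
      ∀ z ∈ A, lineAngle (intCast2 z) = lineAngle y → enorm2 y ≤ enorm2 (intCast2 z)) ∧
    (∀ y y', SingletonMinimizer (intCast2 '' ↑A) y →
      SingletonMinimizer (intCast2 '' ↑A) y' → lineAngle y = lineAngle y' → y = y') := by
  have hneg : ∀ z ∈ intCast2 '' (A : Set (ℤ × ℤ)), z.2 < 0 := by
    rintro _ ⟨z, hz, rfl⟩
    have := hA1 z hz
    simp only [intCast2, Int.cast_lt_zero]
    linarith
  have hangle {v w : ℤ × ℤ} (hv : v ∈ A) (hw : w ∈ A) :
      lineAngle (intCast2 v) = lineAngle (intCast2 w) ↔ v.1 * w.2 = v.2 * w.1 := by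
    rw [lineAngle_eq_iff (hneg _ ⟨v, hv, rfl⟩) (hneg _ ⟨w, hw, rfl⟩)]
    simp only [intCast2]
    norm_cast
  have hexists : ∀ z ∈ A, ∃ y ∈ A, SingletonMinimizer (intCast2 '' ↑A) (intCast2 y) ∧
      lineAngle (intCast2 y) = lineAngle (intCast2 z) := by
    intro z hz
    obtain ⟨y, hy, hmax⟩ := Finset.exists_max_image
      (A.filter fun w => lineAngle (intCast2 w) = lineAngle (intCast2 z)) Prod.snd
      ⟨z, Finset.mem_filter.2 ⟨hz, rfl⟩⟩
    obtain ⟨hyA, hyz⟩ := Finset.mem_filter.1 hy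
    refine ⟨y, hyA, singletonMinimizer_of_snd_le hA1 hyA fun w hw hcross => ?_, hyz⟩
    exact hmax w (Finset.mem_filter.2 ⟨hw, ((hangle hw hyA).2 hcross).trans hyz⟩)
  refine ⟨hexists, ?_, ?_, ?_⟩
  · refine (Set.image_mono fun y hy => hy.1).antisymm ?_
    rintro _ ⟨_, ⟨z, hz, rfl⟩, rfl⟩
    obtain ⟨y, hy, hmin, hyz⟩ := hexists z hz
    exact ⟨intCast2 y, ⟨⟨y, hy, rfl⟩, hmin⟩, hyz⟩
  · intro y hy z hz hzy
    have hzA : intCast2 z ∈ intCast2 '' (A : Set (ℤ × ℤ)) := ⟨z, hz, rfl⟩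
    refine enorm2_le_of_lineAngle_eq (hneg y hy.mem) (hneg _ hzA) hzy ?_
    by_cases hne : intCast2 z = y
    · rw [hne]
    · exact (hy.snd_lt hneg hzA hzy hne).le
  · intro y y' hy hy' heq
    by_contra hne
    exact lt_asymm (hy.snd_lt hneg hy'.mem heq.symm (Ne.symm hne))
      (hy'.snd_lt hneg hy.mem heq hne)
end
end

section
/- Limiting transport direction of Guidefill as μ → ∞ (equation (79)): Let r ≥ 1 be an integer, θ ∈ (0,π), g = (cos θ, sin θ), g^⊥ = (−sin θ, cos θ), and S = {(n,m) ∈ ℤ² : n² + m² ≤ r² and n·sin θ + m·cos θ ≤ −1}. Define F(μ) = Σ_{(n,m)∈S} (n² + m²)^{−1/2} · e^{−μ²m²/(2r²)} · (n·g + m·g^⊥). Then: (1) if sin θ ≥ 1/r, lim_{μ→∞} F(μ) = −(r − ⌈1/sin θ⌉ + 1)·g, a nonzero multiple of g (no kinking); (2) if r ≥ 2 and 0 < θ < arcsin(1/r), lim_{μ→∞} e^{μ²/(2r²)}·F(μ) = −Σ_{k=1}^{r−1} (1 + k²)^{−1/2}·(k·g + g^⊥) = −c·(g + α_r·g^⊥),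 where c = Σ_{k=1}^{r−1} k/√(1+k²) and α_r = (Σ_{k=1}^{r−1} 1/√(1+k²))/(Σ_{k=1}^{r−1} k/√(1+k²)); in particular the limit is not parallel to g (kinking by the angle arctan(α_r)). -/
noncomputable section

open Classical

/-- The guidance direction `g = (cos θ, sin θ)`. -/
def gvec (θ : ℝ) : ℝ × ℝ := (Real.cos θ, Real.sin θ)

/-- Its rotation by +90°, `g^⊥ = (−sin θ, cos θ)`. -/
def gperpvec (θ : ℝ) : ℝ × ℝ := (-Real.sin θ, Real.cos θ)

/-- The rotated stencil `S = {(n,m) ∈ ℤ² : n² + m² ≤ r², n·sin θ + m·cos θ ≤ −1}`. -/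
def stencilS (r : ℤ) (θ : ℝ) : Finset (ℤ × ℤ) :=
  (Finset.Icc (-r) r ×ˢ Finset.Icc (-r) r).filter
    (fun z => z.1 ^ 2 + z.2 ^ 2 ≤ r ^ 2 ∧
      (z.1 : ℝ) * Real.sin θ + (z.2 : ℝ) * Real.cos θ ≤ -1)

/-- The weighted sum `F(μ)` of Guidefill in the limit computation. -/
def Ffun (r : ℤ) (θ : ℝ) (μ : ℝ) : ℝ × ℝ :=
  ∑ z ∈ stencilS r θ,
    (Real.sqrt ((z.1 : ℝ) ^ 2 + (z.2 : ℝ) ^ 2))⁻¹ •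
      (Real.exp (-(μ ^ 2 * (z.2 : ℝ) ^ 2) / (2 * (r : ℝ) ^ 2)) •
        ((z.1 : ℝ) • gvec θ + (z.2 : ℝ) • gperpvec θ))

/-- The limit vector in the shallow-angle (kinking) regime. -/
def kinkLimit (r : ℤ) (θ : ℝ) : ℝ × ℝ :=
  -(∑ k ∈ Finset.Icc (1 : ℤ) (r - 1),
    (Real.sqrt (1 + (k : ℝ) ^ 2))⁻¹ • ((k : ℝ) • gvec θ + gperpvec θ))

theorem mem_stencilS {r : ℤ} (hr : 0 ≤ r) {θ : ℝ} {z : ℤ × ℤ} :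
    z ∈ stencilS r θ ↔ z.1 ^ 2 + z.2 ^ 2 ≤ r ^ 2 ∧
      (z.1 : ℝ) * Real.sin θ + (z.2 : ℝ) * Real.cos θ ≤ -1 := by
  simp only [stencilS, Finset.mem_filter, Finset.mem_product, Finset.mem_Icc,
    and_iff_right_iff_imp, and_imp]
  intro h _
  have h1 := abs_le.mp (abs_le_of_sq_le_sq (by nlinarith [sq_nonneg z.2] : z.1 ^ 2 ≤ r ^ 2) hr)
  have h2 := abs_le.mp (abs_le_of_sq_le_sq (by nlinarith [sq_nonneg z.1] : z.2 ^ 2 ≤ r ^ 2) hr)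
  exact ⟨h1, h2⟩

theorem tendsto_exp_neg_sq_mul {r : ℝ} (hr : 0 < r) {a : ℝ} (ha : 0 ≤ a) :
    Filter.Tendsto (fun μ : ℝ => Real.exp (-(μ ^ 2 * a) / (2 * r ^ 2))) Filter.atTop
      (nhds (if a = 0 then 1 else 0)) := by
  split_ifs with h
  · simp [h]
  · have hc : 0 < a / (2 * r ^ 2) := by positivity
    have : Filter.Tendsto (fun μ : ℝ => -(a / (2 * r ^ 2) * μ ^ 2)) Filter.atTop Filter.atBot :=
      Filter.tendsto_neg_atTop_atBot.comp
        ((Filter.tendsto_pow_atTop two_ne_zero).const_mul_atTop hc)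
    refine (Real.tendsto_exp_atBot.comp this).congr fun μ => ?_
    simp only [Function.comp_apply]
    congr 1
    ring

/-- If every point of the stencil has `m² ≥ a`, only the points with `m² = a` survive in the
limit of `F` rescaled by `e^{aμ²/(2r²)}`. -/
theorem tendsto_exp_smul_Ffun {r : ℤ} (hr : 1 ≤ r) (θ : ℝ) (a : ℤ)
    (ha : ∀ z ∈ stencilS r θ, a ≤ z.2 ^ 2) :
    Filter.Tendsto (fun μ : ℝ => Real.exp (μ ^ 2 * a / (2 * (r : ℝ) ^ 2)) • Ffun r θ μ)
      Filter.atTop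
      (nhds (∑ z ∈ (stencilS r θ).filter (fun z => z.2 ^ 2 = a),
        (Real.sqrt ((z.1 : ℝ) ^ 2 + (z.2 : ℝ) ^ 2))⁻¹ •
          ((z.1 : ℝ) • gvec θ + (z.2 : ℝ) • gperpvec θ))) := by
  have hr0 : (0 : ℝ) < r := by exact_mod_cast hr
  simp only [Ffun, Finset.smul_sum, Finset.sum_filter]
  refine tendsto_finsetSum _ fun z hz => ?_
  have hz' : (0 : ℝ) ≤ (z.2 : ℝ) ^ 2 - a := by
    rw [sub_nonneg]
    exact_mod_cast ha z hz
  have hlim := ((tendsto_exp_neg_sq_mul hr0 hz').smul_const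
    ((z.1 : ℝ) • gvec θ + (z.2 : ℝ) • gperpvec θ)).const_smul
      (Real.sqrt ((z.1 : ℝ) ^ 2 + (z.2 : ℝ) ^ 2))⁻¹
  have hiff : (z.2 : ℝ) ^ 2 - a = 0 ↔ z.2 ^ 2 = a := by
    rw [sub_eq_zero]
    norm_cast
  convert hlim using 2 with μ
  · rw [smul_comm, ← mul_smul (Real.exp _), ← Real.exp_add]
    congr 3
    ring
  · simp only [hiff]
    split_ifs <;> simp

theorem filter_stencilS_axis {r : ℤ} (hr : 1 ≤ r) {θ : ℝ} (hs : 0 < Real.sin θ) :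
    (stencilS r θ).filter (fun z => z.2 ^ 2 = 0) =
      (Finset.Icc ⌈1 / Real.sin θ⌉ r).image (fun k => (-k, 0)) := by
  ext ⟨n, m⟩
  simp only [Finset.mem_filter, mem_stencilS (by lia : 0 ≤ r), Finset.mem_image, Finset.mem_Icc,
    Prod.mk.injEq, Int.ceil_le, div_le_iff₀ hs]
  constructor
  · rintro ⟨⟨h1, h2⟩, h3⟩
    obtain rfl : m = 0 := by simpa using h3
    refine ⟨-n, ⟨?_, ?_⟩, by simp, rfl⟩
    · push_cast at h2 ⊢
      linarith
    · have := abs_le.mp (abs_le_of_sq_le_sq (by simpa using h1 : n ^ 2 ≤ r ^ 2) (by lia))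
      lia
  · rintro ⟨k, ⟨h1, h2⟩, rfl, rfl⟩
    have hk : 0 < k := by
      have : (0 : ℝ) < k := pos_of_mul_pos_left (one_pos.trans_le h1) hs.le
      exact_mod_cast this
    refine ⟨⟨by nlinarith, ?_⟩, by simp⟩
    push_cast
    linarith

theorem one_lt_sin_add_cos {θ : ℝ} (hs : 0 < Real.sin θ) (hc : 0 < Real.cos θ) :
    1 < Real.sin θ + Real.cos θ := by
  nlinarith [Real.sin_sq_add_cos_sq θ, mul_pos hs hc]

theorem neg_one_lt_mul_sin {r n m : ℤ} (hr : 1 ≤ r) {θ : ℝ} (hs : 0 < Real.sin θ)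
    (hsr : Real.sin θ < (r : ℝ)⁻¹) (h : n ^ 2 + m ^ 2 ≤ r ^ 2) :
    -1 < (n : ℝ) * Real.sin θ := by
  have hr0 : (0 : ℝ) < r := by exact_mod_cast hr
  have hn := (abs_le.mp
    (abs_le_of_sq_le_sq (by nlinarith [sq_nonneg m] : n ^ 2 ≤ r ^ 2) (by lia))).1
  have hn' : -(r : ℝ) ≤ n := by exact_mod_cast hn
  rw [← one_div, lt_div_iff₀' hr0] at hsr
  nlinarith

theorem filter_stencilS_adjacent {r : ℤ} (hr : 1 ≤ r) {θ : ℝ} (hs : 0 < Real.sin θ)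
    (hc : 0 < Real.cos θ) (hsr : Real.sin θ < (r : ℝ)⁻¹) :
    (stencilS r θ).filter (fun z => z.2 ^ 2 = 1) =
      (Finset.Icc 1 (r - 1)).image (fun k => (-k, -1)) := by
  ext ⟨n, m⟩
  simp only [Finset.mem_filter, mem_stencilS (by lia : 0 ≤ r), Finset.mem_image, Finset.mem_Icc,
    Prod.mk.injEq]
  constructor
  · rintro ⟨⟨h1, h2⟩, h3⟩
    have hns := neg_one_lt_mul_sin hr hs hsr h1
    rcases sq_eq_sq_iff_eq_or_eq_neg.mp (h3.trans (one_pow 2).symm) with rfl | rfl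
    · push_cast at h2
      linarith
    · refine ⟨-n, ⟨?_, by nlinarith⟩, by simp, rfl⟩
      have hc1 : Real.cos θ < 1 := by nlinarith [Real.sin_sq_add_cos_sq θ]
      push_cast at h2
      have : (n : ℝ) < 0 := by
        by_contra! hn
        nlinarith [mul_nonneg hn hs.le]
      have : n < 0 := by exact_mod_cast this
      lia
  · rintro ⟨k, ⟨h1, h2⟩, rfl, rfl⟩
    refine ⟨⟨by nlinarith, ?_⟩, by simp⟩
    have hk : (1 : ℝ) ≤ k := by exact_mod_cast h1
    push_cast
    nlinarith [one_lt_sin_add_cos hs hc]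

theorem one_le_sq_of_mem_stencilS {r : ℤ} (hr : 1 ≤ r) {θ : ℝ} (hs : 0 < Real.sin θ)
    (hsr : Real.sin θ < (r : ℝ)⁻¹) {z : ℤ × ℤ} (hz : z ∈ stencilS r θ) : 1 ≤ z.2 ^ 2 := by
  rw [mem_stencilS (by lia)] at hz
  have hns := neg_one_lt_mul_sin hr hs hsr hz.1
  have : z.2 ≠ 0 := by
    intro h
    have := hz.2
    rw [h] at this
    push_cast at this
    linarith
  have := sq_pos_of_ne_zero this
  lia

theorem ceil_one_div_le {r : ℤ} (hr : 1 ≤ r) {x : ℝ} (hx : (r : ℝ)⁻¹ ≤ x) : ⌈1 / x⌉ ≤ r := by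
  rw [Int.ceil_le, one_div]
  exact inv_le_of_inv_le₀ (by exact_mod_cast hr) hx

theorem tendsto_Ffun {r : ℤ} (hr : 1 ≤ r) {θ : ℝ} (hsr : (r : ℝ)⁻¹ ≤ Real.sin θ) :
    Filter.Tendsto (Ffun r θ) Filter.atTop
      (nhds (-(((r : ℝ) - ((⌈1 / Real.sin θ⌉ : ℤ) : ℝ) + 1) • gvec θ))) := by
  have hr0 : (0 : ℝ) < r := by exact_mod_cast hr
  have hs : 0 < Real.sin θ := (inv_pos.mpr hr0).trans_le hsr
  have hceil := ceil_one_div_le hr hsr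
  have hpos : 0 < ⌈1 / Real.sin θ⌉ := Int.ceil_pos.mpr (by positivity)
  have h := tendsto_exp_smul_Ffun hr θ 0 fun z _ => sq_nonneg z.2
  rw [filter_stencilS_axis hr hs, Finset.sum_image (by simp [Set.InjOn])] at h
  have hsum : ∑ k ∈ Finset.Icc ⌈1 / Real.sin θ⌉ r,
      (Real.sqrt (((-k : ℤ) : ℝ) ^ 2 + ((0 : ℤ) : ℝ) ^ 2))⁻¹ •
        (((-k : ℤ) : ℝ) • gvec θ + ((0 : ℤ) : ℝ) • gperpvec θ) =
      ∑ _k ∈ Finset.Icc ⌈1 / Real.sin θ⌉ r, -gvec θ := by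
    refine Finset.sum_congr rfl fun k hk => ?_
    have hk0 : (0 : ℝ) < k := by exact_mod_cast hpos.trans_le (Finset.mem_Icc.mp hk).1
    simp [Real.sqrt_sq hk0.le, smul_smul, hk0.ne']
  rw [hsum, Finset.sum_const, Int.card_Icc, ← Nat.cast_smul_eq_nsmul ℝ, ← Int.cast_natCast,
    Int.toNat_of_nonneg (by lia), smul_neg] at h
  convert h using 1
  · ext μ <;> simp
  · push_cast
    congr 3
    ring

theorem tendsto_exp_smul_Ffun_kinkLimit {r : ℤ} (hr : 1 ≤ r) {θ : ℝ} (hs : 0 < Real.sin θ)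
    (hc : 0 < Real.cos θ) (hsr : Real.sin θ < (r : ℝ)⁻¹) :
    Filter.Tendsto (fun μ : ℝ => Real.exp (μ ^ 2 / (2 * (r : ℝ) ^ 2)) • Ffun r θ μ)
      Filter.atTop (nhds (kinkLimit r θ)) := by
  have h := tendsto_exp_smul_Ffun hr θ 1 fun z hz => one_le_sq_of_mem_stencilS hr hs hsr hz
  rw [filter_stencilS_adjacent hr hs hc hsr, Finset.sum_image (by simp [Set.InjOn])] at h
  convert h using 1
  · simp
  · rw [kinkLimit, ← Finset.sum_neg_distrib]
    congr 1
    refine Finset.sum_congr rfl fun k _ => ?_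
    push_cast
    rw [← smul_neg, neg_add, neg_sq, neg_one_sq, add_comm (1 : ℝ), neg_smul, neg_one_smul]

theorem kinkLimit_eq_smul_add_smul (r : ℤ) (θ : ℝ) :
    kinkLimit r θ =
      -((∑ k ∈ Finset.Icc (1 : ℤ) (r - 1), (k : ℝ) / Real.sqrt (1 + (k : ℝ) ^ 2)) • gvec θ +
        (∑ k ∈ Finset.Icc (1 : ℤ) (r - 1), (Real.sqrt (1 + (k : ℝ) ^ 2))⁻¹) • gperpvec θ) := by
  simp only [kinkLimit, smul_add, smul_smul, Finset.sum_add_distrib, Finset.sum_smul,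
    div_eq_inv_mul]

theorem smul_gvec_add_smul_gperpvec_ne {θ a b : ℝ} (hb : b ≠ 0) (t : ℝ) :
    a • gvec θ + b • gperpvec θ ≠ t • gvec θ := by
  intro h
  simp only [gvec, gperpvec, Prod.smul_mk, Prod.mk_add_mk, Prod.mk.injEq, smul_eq_mul] at h
  apply hb
  linear_combination (-Real.sin θ) * h.1 + Real.cos θ * h.2 - b * Real.sin_sq_add_cos_sq θ

/-- **Limiting transport direction of Guidefill as μ → ∞ (equation (79)).**
(1) If `sin θ ≥ 1/r`, then `F(μ) → −(r − ⌈1/sin θ⌉ + 1)·g`, a nonzero multiple of `g`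
(no kinking).  (2) If `r ≥ 2` and `0 < θ < arcsin(1/r)`, then
`e^{μ²/(2r²)}·F(μ) → −Σ_{k=1}^{r−1} (1+k²)^{−1/2}·(k·g + g^⊥) = −c·(g + α_r·g^⊥)`,
which is not parallel to `g` (kinking by the angle `arctan α_r`). -/
theorem guidefill_limiting_direction
    (r : ℤ) (hr : 1 ≤ r) (θ : ℝ) (hθ0 : 0 < θ) (hθπ : θ < Real.pi) :
    ((r : ℝ)⁻¹ ≤ Real.sin θ →
      (Filter.Tendsto (Ffun r θ) Filter.atTop
        (nhds (-(((r : ℝ) - ((⌈1 / Real.sin θ⌉ : ℤ) : ℝ) + 1) • gvec θ))) ∧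
       (r : ℝ) - ((⌈1 / Real.sin θ⌉ : ℤ) : ℝ) + 1 ≠ 0)) ∧
    (2 ≤ r → θ < Real.arcsin (r : ℝ)⁻¹ →
      (Filter.Tendsto (fun μ : ℝ => Real.exp (μ ^ 2 / (2 * (r : ℝ) ^ 2)) • Ffun r θ μ)
        Filter.atTop (nhds (kinkLimit r θ)) ∧
       kinkLimit r θ
          = -((∑ k ∈ Finset.Icc (1 : ℤ) (r - 1), (k : ℝ) / Real.sqrt (1 + (k : ℝ) ^ 2)) •
              (gvec θ +
                ((∑ k ∈ Finset.Icc (1 : ℤ) (r - 1), (Real.sqrt (1 + (k : ℝ) ^ 2))⁻¹) /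
                 (∑ k ∈ Finset.Icc (1 : ℤ) (r - 1), (k : ℝ) / Real.sqrt (1 + (k : ℝ) ^ 2)))
                  • gperpvec θ)) ∧
       ¬ ∃ t : ℝ, kinkLimit r θ = t • gvec θ)) := by
  have hs : 0 < Real.sin θ := Real.sin_pos_of_pos_of_lt_pi hθ0 hθπ
  refine ⟨fun hsr => ⟨tendsto_Ffun hr hsr, ?_⟩, fun hr2 hθr => ?_⟩
  · have : ((⌈1 / Real.sin θ⌉ : ℤ) : ℝ) ≤ r := by exact_mod_cast ceil_one_div_le hr hsr
    linarith
  · have hθ2 : θ < Real.pi / 2 := hθr.trans_le (Real.arcsin_le_pi_div_two _)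
    have hc : 0 < Real.cos θ := Real.cos_pos_of_mem_Ioo ⟨by linarith, hθ2⟩
    have hsr : Real.sin θ < (r : ℝ)⁻¹ :=
      (Real.lt_arcsin_iff_sin_lt' ⟨by linarith, hθ2⟩).mp hθr
    have hne : (Finset.Icc (1 : ℤ) (r - 1)).Nonempty := Finset.nonempty_Icc.mpr (by lia)
    have hcpos : 0 < ∑ k ∈ Finset.Icc (1 : ℤ) (r - 1), (k : ℝ) / Real.sqrt (1 + (k : ℝ) ^ 2) := by
      refine Finset.sum_pos (fun k hk => ?_) hne
      have : (0 : ℝ) < k := by exact_mod_cast (Finset.mem_Icc.mp hk).1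
      positivity
    have hbpos : 0 < ∑ k ∈ Finset.Icc (1 : ℤ) (r - 1), (Real.sqrt (1 + (k : ℝ) ^ 2))⁻¹ :=
      Finset.sum_pos (fun k _ => by positivity) hne
    refine ⟨tendsto_exp_smul_Ffun_kinkLimit hr hs hc hsr, ?_, ?_⟩
    · rw [kinkLimit_eq_smul_add_smul, smul_add, smul_smul, mul_div_cancel₀ _ hcpos.ne']
    · rintro ⟨t, ht⟩
      rw [kinkLimit_eq_smul_add_smul, neg_eq_iff_eq_neg, ← neg_smul] at ht
      exact smul_gvec_add_smul_gperpvec_ne hbpos.ne' _ ht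
end
end

section
/- Limiting transport direction of semi-implicit Guidefill as μ → ∞ (equation (80)): Let r ≥ 1 be an integer, θ ∈ (0,π), g = (cos θ, sin θ), g^⊥ = (−sin θ, cos θ), and S⁰ = {(n,m) ∈ ℤ² : 0 < n² + m² ≤ r² and n·sin θ + m·cos θ ≤ 0}. Then lim_{μ→∞} Σ_{(n,m)∈S⁰} (n² + m²)^{−1/2} · e^{−μ²m²/(2r²)} · (n·g + m·g^⊥) = −r·g. In particular, the limiting transport direction of semi-implicit Guidefill is parallel to the guidance direction g for every θ ∈ (0,π), independent of r. -/
noncomputable section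

open Classical

/-- The semi-implicit rotated stencil
`S⁰ = {(n,m) ∈ ℤ² : 0 < n² + m² ≤ r², n·sin θ + m·cos θ ≤ 0}`. -/
def stencilS0 (r : ℤ) (θ : ℝ) : Finset (ℤ × ℤ) :=
  (Finset.Icc (-r) r ×ˢ Finset.Icc (-r) r).filter
    (fun z => 0 < z.1 ^ 2 + z.2 ^ 2 ∧ z.1 ^ 2 + z.2 ^ 2 ≤ r ^ 2 ∧
      (z.1 : ℝ) * Real.sin θ + (z.2 : ℝ) * Real.cos θ ≤ 0)

theorem mem_stencilS0_axis_iff {r : ℤ} {θ : ℝ} (hθ0 : 0 < θ) (hθπ : θ < Real.pi) (n : ℤ) :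
    (n, (0 : ℤ)) ∈ stencilS0 r θ ↔ n ∈ Finset.Icc (-r) (-1) := by
  have hs : 0 < Real.sin θ := Real.sin_pos_of_pos_of_lt_pi hθ0 hθπ
  simp only [stencilS0, Finset.mem_filter, Finset.mem_product, Finset.mem_Icc, Int.cast_zero,
    zero_mul, add_zero]
  constructor
  · rintro ⟨⟨⟨h1, -⟩, -⟩, h2, -, h3⟩
    refine ⟨h1, ?_⟩
    have hn : (n : ℝ) ≤ 0 := nonpos_of_mul_nonpos_left h3 hs
    have hn' : n ≤ 0 := by exact_mod_cast hn
    have : n ≠ 0 := by rintro rfl; simp at h2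
    omega
  · rintro ⟨h1, h2⟩
    have hn : (n : ℝ) ≤ 0 := by exact_mod_cast (by omega : n ≤ 0)
    exact ⟨⟨⟨h1, by omega⟩, by omega, by omega⟩, by nlinarith, by nlinarith,
      mul_nonpos_of_nonpos_of_nonneg hn hs.le⟩

theorem card_stencilS0_axis {r : ℤ} (hr : 0 ≤ r) {θ : ℝ} (hθ0 : 0 < θ) (hθπ : θ < Real.pi) :
    (((stencilS0 r θ).filter (fun z => z.2 = 0)).card : ℝ) = r := by
  have h : (stencilS0 r θ).filter (fun z => z.2 = 0) =
      (Finset.Icc (-r) (-1)).image (fun n : ℤ => (n, (0 : ℤ))) := by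
    ext ⟨n, m⟩
    simp only [Finset.mem_filter, Finset.mem_image, Prod.mk.injEq]
    constructor
    · rintro ⟨h, rfl⟩
      exact ⟨n, (mem_stencilS0_axis_iff hθ0 hθπ n).1 h, rfl, rfl⟩
    · rintro ⟨n, h, rfl, rfl⟩
      exact ⟨(mem_stencilS0_axis_iff hθ0 hθπ n).2 h, rfl⟩
  rw [h, Finset.card_image_of_injective _ (fun a b hab => congrArg Prod.fst hab), Int.card_Icc]
  have : ((-1 + 1 - -r).toNat : ℤ) = r := by omega
  exact_mod_cast this

theorem tendsto_exp_neg_sq_mul_div {a b : ℝ} (ha : 0 < a) (hb : 0 < b) :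
    Filter.Tendsto (fun μ : ℝ => Real.exp (-(μ ^ 2 * a) / b)) Filter.atTop (nhds 0) := by
  refine Real.tendsto_exp_atBot.comp ?_
  simp only [neg_div]
  exact Filter.tendsto_neg_atTop_atBot.comp
    (((Filter.tendsto_pow_atTop two_ne_zero).atTop_mul_const ha).atTop_div_const hb)

/-- **Limiting transport direction of semi-implicit Guidefill as μ → ∞ (equation (80)).**
For every integer `r ≥ 1` and every `θ ∈ (0, π)`,
`lim_{μ→∞} Σ_{(n,m)∈S⁰} (n²+m²)^{−1/2}·e^{−μ²m²/(2r²)}·(n·g + m·g^⊥) = −r·g`;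
in particular the limiting transport direction is parallel to the guidance direction `g`
for every `θ ∈ (0,π)`, independent of `r`. -/
theorem semi_implicit_guidefill_limiting_direction
    (r : ℤ) (hr : 1 ≤ r) (θ : ℝ) (hθ0 : 0 < θ) (hθπ : θ < Real.pi) :
    Filter.Tendsto
      (fun μ : ℝ => ∑ z ∈ stencilS0 r θ,
        (Real.sqrt ((z.1 : ℝ) ^ 2 + (z.2 : ℝ) ^ 2))⁻¹ •
          (Real.exp (-(μ ^ 2 * (z.2 : ℝ) ^ 2) / (2 * (r : ℝ) ^ 2)) •
            ((z.1 : ℝ) • gvec θ + (z.2 : ℝ) • gperpvec θ)))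
      Filter.atTop (nhds (-((r : ℝ) • gvec θ))) := by
  have hr0 : (0 : ℝ) < r := by exact_mod_cast hr
  have hsum : ∑ z ∈ stencilS0 r θ, (if z.2 = 0 then -gvec θ else 0) = -((r : ℝ) • gvec θ) := by
    rw [← Finset.sum_filter, Finset.sum_const, ← Nat.cast_smul_eq_nsmul ℝ,
      card_stencilS0_axis (by omega) hθ0 hθπ, smul_neg]
  rw [← hsum]
  refine tendsto_finsetSum _ ?_
  rintro ⟨n, m⟩ hz
  by_cases hm : m = 0
  · subst hm
    have hn := Finset.mem_Icc.1 ((mem_stencilS0_axis_iff hθ0 hθπ n).1 hz)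
    have hn0 : (n : ℝ) < 0 := by exact_mod_cast (by omega : n < 0)
    have hterm : (Real.sqrt ((n : ℝ) ^ 2))⁻¹ • ((n : ℝ) • gvec θ) = -gvec θ := by
      rw [Real.sqrt_sq_eq_abs, abs_of_neg hn0, smul_smul, inv_neg, neg_mul,
        inv_mul_cancel₀ hn0.ne, neg_one_smul]
    simp [hterm]
  · have hm2 : (0 : ℝ) < (m : ℝ) ^ 2 := by positivity
    simpa [hm] using ((tendsto_exp_neg_sq_mul_div hm2 (b := 2 * (r : ℝ) ^ 2)
      (by positivity)).smul_const ((n : ℝ) • gvec θ + (m : ℝ) • gperpvec θ)).const_smul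
        (Real.sqrt ((n : ℝ) ^ 2 + (m : ℝ) ^ 2))⁻¹
end
end
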